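/- Let μ ∈ N be nonzero and let g ∈ GL(n,ℂ). Suppose Ric^{c}_μ = c·I + D for some c ∈ ℝ and D ∈ Der(μ), and also Ric^{c}_{g.μ} = c′·I + D′ for some c′ ∈ ℝ and D′ ∈ Der(g.μ). Then there exist k ∈ U(n) and t ≠ 0 such that g.μ = t·(k.μ). (A minimal compatible metric on an (almost-)complex nilpotent Lie group is unique up to isometry and scaling.) -/

import Mathlib

open scoped BigOperators
open Matrix

noncomputable section

/-- vectors in `ℝ^m`. -/
abbrev Vec (m : ℕ) := Fin m → ℝ

/-- bilinear-map candidates `ℝ^m × ℝ^m → ℝ^m`. -/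
abbrev Bil (m : ℕ) := Vec m → Vec m → Vec m

/-- the `i`-th standard basis vector of `ℝ^m`. -/
def bvec (m : ℕ) (i : Fin m) : Vec m := Pi.single i 1

/-- `μ` is a skew-symmetric bilinear map, i.e. an element of `V = Λ²(ℝ^m)* ⊗ ℝ^m`. -/
def IsSkewBil {m : ℕ} (μ : Bil m) : Prop :=
  (∀ Y, IsLinearMap ℝ fun X => μ X Y) ∧ (∀ X, IsLinearMap ℝ (μ X)) ∧ ∀ X Y, μ X Y = -μ Y X

/-- the Jacobi identity for `μ`. -/
def IsJacobi {m : ℕ} (μ : Bil m) : Prop :=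
  ∀ X Y Z, μ (μ X Y) Z + μ (μ Y Z) X + μ (μ Z X) Y = 0

/-- iterated left multiplications `μ(X (k-1), ⋯ μ(X 0, Y))`. -/
def adPow {m : ℕ} (μ : Bil m) (X : ℕ → Vec m) : ℕ → Vec m → Vec m
  | 0, Y => Y
  | k + 1, Y => μ (X k) (adPow μ X k Y)

/-- nilpotency of the bracket `μ`. -/
def IsNilpotentBil {m : ℕ} (μ : Bil m) : Prop :=
  ∃ k : ℕ, ∀ (X : ℕ → Vec m) (Y : Vec m), adPow μ X k Y = 0

/-- membership in the variety `N` of nilpotent Lie brackets on `ℝ^m`. -/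
def NilBracket {m : ℕ} (μ : Bil m) : Prop :=
  IsSkewBil μ ∧ IsJacobi μ ∧ IsNilpotentBil μ

/-- the `GL_m(ℝ)` action `(g.μ)(X,Y) = g μ(g⁻¹X, g⁻¹Y)` on `V`. -/
def mact {m : ℕ} (g : Matrix (Fin m) (Fin m) ℝ) (μ : Bil m) : Bil m :=
  fun X Y => g.mulVec (μ (g⁻¹.mulVec X) (g⁻¹.mulVec Y))

/-- `‖μ‖²` for the natural inner product on `V`. -/
def normSqV {m : ℕ} (μ : Bil m) : ℝ :=
  ∑ i, ∑ j, ∑ k, (μ (bvec m i) (bvec m j) k) ^ 2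

/-- the Ricci operator of `(N_μ, ⟨·,·⟩)`, as a matrix:
`⟨Ric_μ X, Y⟩ = -(1/2) Σ ⟨μ(X,Xᵢ),Xⱼ⟩⟨μ(Y,Xᵢ),Xⱼ⟩ + (1/4) Σ ⟨μ(Xᵢ,Xⱼ),X⟩⟨μ(Xᵢ,Xⱼ),Y⟩`. -/
def RicM {m : ℕ} (μ : Bil m) : Matrix (Fin m) (Fin m) ℝ :=
  Matrix.of fun x y =>
    -(1/2) * (∑ i, ∑ j, μ (bvec m x) (bvec m i) j * μ (bvec m y) (bvec m i) j)
    + (1/4) * (∑ i, ∑ j, μ (bvec m i) (bvec m j) x * μ (bvec m i) (bvec m j) y)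

/-- `D` is a derivation of the bracket `μ`. -/
def IsDerivation {m : ℕ} (μ : Bil m) (D : Matrix (Fin m) (Fin m) ℝ) : Prop :=
  ∀ X Y, D.mulVec (μ X Y) = μ (D.mulVec X) Y + μ X (D.mulVec Y)

/-- the matrix of `ad_μ X : Y ↦ μ(X,Y)`. -/
def adMat {m : ℕ} (μ : Bil m) (X : Vec m) : Matrix (Fin m) (Fin m) ℝ :=
  Matrix.of fun j i => μ X (bvec m i) j

/-- the moment-map value `M_μ = -4 Σᵢ (ad_μ Xᵢ)ᵗ(ad_μ Xᵢ) + 2 Σᵢ (ad_μ Xᵢ)(ad_μ Xᵢ)ᵗ`. -/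
def Mmat {m : ℕ} (μ : Bil m) : Matrix (Fin m) (Fin m) ℝ :=
  (-4 : ℝ) • (∑ i, (adMat μ (bvec m i))ᵀ * adMat μ (bvec m i))
    + (2 : ℝ) • (∑ i, adMat μ (bvec m i) * (adMat μ (bvec m i))ᵀ)

/-- the 2-form `ω(X,Y) = ⟨X, JY⟩`. -/
def sympForm {m : ℕ} (J : Matrix (Fin m) (Fin m) ℝ) (X Y : Vec m) : ℝ :=
  X ⬝ᵥ J.mulVec Y

/-- closedness of a 2-form `ω` with respect to the bracket `μ`:
`ω(μ(X,Y),Z) + ω(μ(Y,Z),X) + ω(μ(Z,X),Y) = 0`. -/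
def IsClosedForm {m : ℕ} (ω : Vec m → Vec m → ℝ) (μ : Bil m) : Prop :=
  ∀ X Y Z, ω (μ X Y) Z + ω (μ Y Z) X + ω (μ Z X) Y = 0

/-- membership in `Sp(n,ℝ)`: invertible and preserving `ω = ⟨·, J·⟩`. -/
def IsSymplMat {m : ℕ} (J g : Matrix (Fin m) (Fin m) ℝ) : Prop :=
  IsUnit g ∧ ∀ X Y, sympForm J (g.mulVec X) (g.mulVec Y) = sympForm J X Y

/-- membership in `GL(n,ℂ) = {g : gJ = Jg}`. -/
def IsCxMat {m : ℕ} (J g : Matrix (Fin m) (Fin m) ℝ) : Prop :=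
  IsUnit g ∧ g * J = J * g

/-- the anti-complexified Ricci operator `Ric^{ac} = (1/2)(Ric + J Ric J)`. -/
def Ricac {m : ℕ} (J : Matrix (Fin m) (Fin m) ℝ) (μ : Bil m) : Matrix (Fin m) (Fin m) ℝ :=
  (1/2 : ℝ) • (RicM μ + J * RicM μ * J)

/-- the complexified Ricci operator `Ric^{c} = (1/2)(Ric − J Ric J)`. -/
def Ricc {m : ℕ} (J : Matrix (Fin m) (Fin m) ℝ) (μ : Bil m) : Matrix (Fin m) (Fin m) ℝ :=
  (1/2 : ℝ) • (RicM μ - J * RicM μ * J)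


section helpers
variable {m : ℕ}

theorem skew_expand {μ : Bil m} (h : IsSkewBil μ) (X Y : Vec m) :
    μ X Y = ∑ a, ∑ b, (X a * Y b) • μ (bvec m a) (bvec m b) := by
  have hX : X = ∑ a, X a • bvec m a := by
    ext i; simp [bvec, Pi.single_apply]
  have hY : Y = ∑ a, Y a • bvec m a := by
    ext i; simp [bvec, Pi.single_apply]
  have h1 : μ X Y = ∑ a, X a • μ (bvec m a) Y := by
    have := map_sum (IsLinearMap.mk' _ (h.1 Y)) (fun a => X a • bvec m a) Finset.univ
    rw [← hX] at this
    simpa only [map_smul, IsLinearMap.mk'_apply] using this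
  rw [h1]
  refine Finset.sum_congr rfl fun a _ => ?_
  have := map_sum (IsLinearMap.mk' _ (h.2.1 (bvec m a))) (fun a => Y a • bvec m a) Finset.univ
  rw [← hY] at this
  simp only [map_smul, IsLinearMap.mk'_apply] at this
  rw [this, Finset.smul_sum]
  simp only [smul_smul]

theorem skew_expand_apply {μ : Bil m} (h : IsSkewBil μ) (X Y : Vec m) (k : Fin m) :
    μ X Y k = ∑ a, ∑ b, X a * Y b * μ (bvec m a) (bvec m b) k := by
  rw [skew_expand h X Y]
  simp

theorem skew_ext {μ ν : Bil m} (h : IsSkewBil μ) (h' : IsSkewBil ν)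
    (H : ∀ i j k, μ (bvec m i) (bvec m j) k = ν (bvec m i) (bvec m j) k) : μ = ν := by
  funext X Y k
  rw [skew_expand_apply h, skew_expand_apply h']
  simp only [H]

theorem mact_skew {μ : Bil m} (h : IsSkewBil μ) (g : Matrix (Fin m) (Fin m) ℝ) :
    IsSkewBil (mact g μ) := by
  refine ⟨fun Y => ⟨fun X X' => ?_, fun c X => ?_⟩, fun Y => ⟨fun X X' => ?_, fun c X => ?_⟩,
    fun X Y => ?_⟩
  · simp only [mact, Matrix.mulVec_add, (h.1 _).map_add]
  · simp only [mact, Matrix.mulVec_smul, (h.1 _).map_smul]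
  · simp only [mact, Matrix.mulVec_add, (h.2.1 _).map_add]
  · simp only [mact, Matrix.mulVec_smul, (h.2.1 _).map_smul]
  · simp only [mact]
    rw [h.2.2, Matrix.mulVec_neg]

theorem smul_skew {μ : Bil m} (h : IsSkewBil μ) (t : ℝ) : IsSkewBil (t • μ) := by
  refine ⟨fun Y => ⟨fun X X' => ?_, fun c X => ?_⟩, fun Y => ⟨fun X X' => ?_, fun c X => ?_⟩,
    fun X Y => ?_⟩
  · simp only [Pi.smul_apply, (h.1 _).map_add, smul_add]
  · simp only [Pi.smul_apply, (h.1 _).map_smul, smul_comm t c]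
  · simp only [Pi.smul_apply, (h.2.1 _).map_add, smul_add]
  · simp only [Pi.smul_apply, (h.2.1 _).map_smul, smul_comm t c]
  · simp only [Pi.smul_apply]
    rw [h.2.2, smul_neg]

theorem mact_mul (g h : Matrix (Fin m) (Fin m) ℝ) (μ : Bil m) :
    mact (g * h) μ = mact g (mact h μ) := by
  funext X Y
  simp [mact, Matrix.mul_inv_rev, Matrix.mulVec_mulVec]

theorem mact_one (μ : Bil m) : mact 1 μ = μ := by
  funext X Y
  simp [mact]

theorem mact_smul (g : Matrix (Fin m) (Fin m) ℝ) (t : ℝ) (μ : Bil m) :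
    mact g (t • μ) = t • mact g μ := by
  funext X Y
  simp [mact, Matrix.mulVec_smul]

/-- infinitesimal action -/
def derAct (E : Matrix (Fin m) (Fin m) ℝ) (μ : Bil m) : Bil m :=
  fun X Y => E *ᵥ μ X Y - μ (E *ᵥ X) Y - μ X (E *ᵥ Y)

/-- inner product of brackets -/
def ipV (μ ν : Bil m) : ℝ := ∑ i, ∑ j, μ (bvec m i) (bvec m j) ⬝ᵥ ν (bvec m i) (bvec m j)

theorem derAct_skew {μ : Bil m} (h : IsSkewBil μ) (E : Matrix (Fin m) (Fin m) ℝ) :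
    IsSkewBil (derAct E μ) := by
  refine ⟨fun Y => ⟨fun X X' => ?_, fun c X => ?_⟩, fun Y => ⟨fun X X' => ?_, fun c X => ?_⟩,
    fun X Y => ?_⟩
  · simp only [derAct, Matrix.mulVec_add, (h.1 _).map_add]; abel
  · simp only [derAct, Matrix.mulVec_smul, (h.1 _).map_smul, smul_sub]
  · simp only [derAct, Matrix.mulVec_add, (h.2.1 _).map_add]; abel
  · simp only [derAct, Matrix.mulVec_smul, (h.2.1 _).map_smul, smul_sub]
  · simp only [derAct]
    rw [h.2.2 X Y, h.2.2 (E *ᵥ X) Y, h.2.2 X (E *ᵥ Y), Matrix.mulVec_neg]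
    abel

theorem derAct_of_derivation {μ : Bil m} {E : Matrix (Fin m) (Fin m) ℝ}
    (h : IsDerivation μ E) : derAct E μ = 0 := by
  funext X Y
  simp only [derAct, h X Y]
  simp

theorem derAct_coord {μ : Bil m} (h : IsSkewBil μ) (E : Matrix (Fin m) (Fin m) ℝ) (i j k : Fin m) :
    derAct E μ (bvec m i) (bvec m j) k =
      ∑ l, E k l * μ (bvec m i) (bvec m j) l - ∑ l, E l i * μ (bvec m l) (bvec m j) k
       - ∑ l, E l j * μ (bvec m i) (bvec m l) k := by
  simp only [derAct, Pi.sub_apply]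
  rw [skew_expand_apply h (E *ᵥ bvec m i), skew_expand_apply h _ (E *ᵥ bvec m j)]
  congr 1
  · congr 1
    refine Finset.sum_congr rfl fun a _ => ?_
    simp [bvec, Pi.single_apply]
  · simp [bvec, Pi.single_apply]

theorem ricM_trace {μ : Bil m} (h : IsSkewBil μ) (E : Matrix (Fin m) (Fin m) ℝ) :
    (RicM μ * E).trace = 1/4 * ipV (derAct E μ) μ := by
  have hs : ∀ i j k, μ (bvec m i) (bvec m j) k = - μ (bvec m j) (bvec m i) k := by
    intro i j k
    conv_lhs => rw [h.2.2]
    rfl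
  have e1 : ipV (derAct E μ) μ =
      ∑ i, ∑ j, ∑ k, ∑ l, E k l * μ (bvec m i) (bvec m j) l * μ (bvec m i) (bvec m j) k
      - ∑ i, ∑ j, ∑ k, ∑ l, E l i * μ (bvec m l) (bvec m j) k * μ (bvec m i) (bvec m j) k
      - ∑ i, ∑ j, ∑ k, ∑ l, E l j * μ (bvec m i) (bvec m l) k * μ (bvec m i) (bvec m j) k := by
    simp only [ipV, dotProduct, derAct_coord h, sub_mul, Finset.sum_sub_distrib, Finset.sum_mul]
  have e2 : ∑ i, ∑ j, ∑ k, ∑ l, E l j * μ (bvec m i) (bvec m l) k * μ (bvec m i) (bvec m j) k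
      = ∑ i, ∑ j, ∑ k, ∑ l, E l i * μ (bvec m l) (bvec m j) k * μ (bvec m i) (bvec m j) k := by
    rw [Finset.sum_comm]
    refine Finset.sum_congr rfl fun i _ => Finset.sum_congr rfl fun j _ =>
      Finset.sum_congr rfl fun k _ => Finset.sum_congr rfl fun l _ => ?_
    rw [hs j l, hs j i]; ring
  have e3 : ∑ i, ∑ j, ∑ k, ∑ l, E l i * μ (bvec m l) (bvec m j) k * μ (bvec m i) (bvec m j) k
      = ∑ x, ∑ y, (∑ i, ∑ j, μ (bvec m x) (bvec m i) j * μ (bvec m y) (bvec m i) j) * E y x := by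
    simp only [Finset.sum_mul]
    refine Finset.sum_congr rfl fun x _ => ?_
    have : ∀ i, ∑ k, ∑ l, E l x * μ (bvec m l) (bvec m i) k * μ (bvec m x) (bvec m i) k =
      ∑ l, ∑ k, E l x * μ (bvec m l) (bvec m i) k * μ (bvec m x) (bvec m i) k :=
      fun i => Finset.sum_comm
    simp only [this]
    rw [Finset.sum_comm]
    refine Finset.sum_congr rfl fun i _ => Finset.sum_congr rfl fun j _ =>
      Finset.sum_congr rfl fun k _ => ?_
    ring
  have e4 : ∑ i, ∑ j, ∑ k, ∑ l, E k l * μ (bvec m i) (bvec m j) l * μ (bvec m i) (bvec m j) k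
      = ∑ x, ∑ y, (∑ i, ∑ j, μ (bvec m i) (bvec m j) x * μ (bvec m i) (bvec m j) y) * E y x := by
    simp only [Finset.sum_mul]
    have a1 : ∀ i, ∑ j, ∑ k, ∑ l, E k l * μ (bvec m i) (bvec m j) l * μ (bvec m i) (bvec m j) k
      = ∑ k, ∑ l, ∑ j, E k l * μ (bvec m i) (bvec m j) l * μ (bvec m i) (bvec m j) k := by
      intro i
      rw [Finset.sum_comm]
      exact Finset.sum_congr rfl fun k _ => Finset.sum_comm
    simp only [a1]
    rw [Finset.sum_comm]
    have a2 : ∀ k, ∑ i, ∑ l, ∑ j, E k l * μ (bvec m i) (bvec m j) l * μ (bvec m i) (bvec m j) k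
      = ∑ l, ∑ i, ∑ j, E k l * μ (bvec m i) (bvec m j) l * μ (bvec m i) (bvec m j) k :=
      fun k => Finset.sum_comm
    simp only [a2]
    rw [Finset.sum_comm]
    refine Finset.sum_congr rfl fun i _ => Finset.sum_congr rfl fun j _ =>
      Finset.sum_congr rfl fun k _ => Finset.sum_congr rfl fun l _ => ?_
    ring
  rw [e1, e2, e3, e4]
  simp only [Matrix.trace, Matrix.diag_apply, Matrix.mul_apply, RicM, Matrix.of_apply, add_mul,
    Finset.sum_add_distrib, mul_assoc, ← Finset.mul_sum]
  ring

theorem ricc_trace {J : Matrix (Fin m) (Fin m) ℝ} (hJ : J * J = -1) {μ : Bil m}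
    (h : IsSkewBil μ) {E : Matrix (Fin m) (Fin m) ℝ} (hE : E * J = J * E) :
    (Ricc J μ * E).trace = 1/4 * ipV (derAct E μ) μ := by
  rw [← ricM_trace h]
  have : (J * RicM μ * J * E).trace = - (RicM μ * E).trace := by
    rw [mul_assoc, ← hE, mul_assoc J, Matrix.trace_mul_comm, mul_assoc, mul_assoc E, hJ]
    simp
  simp only [Ricc, smul_mul_assoc, sub_mul, Matrix.trace_smul, Matrix.trace_sub, this]
  simp; ring

theorem ipV_mact {μ ν : Bil m} (h : IsSkewBil μ) (h' : IsSkewBil ν)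
    {U : Matrix (Fin m) (Fin m) ℝ} (hU : Uᵀ * U = 1) :
    ipV (mact U μ) (mact U ν) = ipV μ ν := by
  have hU' : U * Uᵀ = 1 := mul_eq_one_comm.mp hU
  have hinv : U⁻¹ = Uᵀ := Matrix.inv_eq_left_inv hU
  have hdot : ∀ x y : Vec m, (U *ᵥ x) ⬝ᵥ (U *ᵥ y) = x ⬝ᵥ y := by
    intro x y
    rw [Matrix.dotProduct_mulVec, Matrix.vecMul_mulVec, hU]
    simp
  have key : ∀ F G : Vec m → Vec m, IsLinearMap ℝ F → IsLinearMap ℝ G →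
      ∑ i, F (Uᵀ *ᵥ bvec m i) ⬝ᵥ G (Uᵀ *ᵥ bvec m i) = ∑ i, F (bvec m i) ⬝ᵥ G (bvec m i) := by
    intro F G hF hG
    obtain ⟨M, rfl⟩ : ∃ M : Matrix (Fin m) (Fin m) ℝ, F = fun x => M *ᵥ x :=
      ⟨LinearMap.toMatrix' (IsLinearMap.mk' F hF), by funext x; simp⟩
    obtain ⟨N, rfl⟩ : ∃ M : Matrix (Fin m) (Fin m) ℝ, G = fun x => M *ᵥ x :=
      ⟨LinearMap.toMatrix' (IsLinearMap.mk' G hG), by funext x; simp⟩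
    have tr : ∀ A B : Matrix (Fin m) (Fin m) ℝ,
        ∑ i, (A *ᵥ bvec m i) ⬝ᵥ (B *ᵥ bvec m i) = (Aᵀ * B).trace := by
      intro A B
      simp [Matrix.trace, Matrix.mul_apply, bvec, dotProduct]
    simp only [Matrix.mulVec_mulVec, tr]
    rw [Matrix.transpose_mul, Matrix.transpose_transpose, mul_assoc, Matrix.trace_mul_comm,
      ← mul_assoc, mul_assoc, hU, mul_one]
  simp only [ipV, mact, hinv, hdot]
  have k1 : ∀ i, ∑ j, μ (Uᵀ *ᵥ bvec m i) (Uᵀ *ᵥ bvec m j) ⬝ᵥ ν (Uᵀ *ᵥ bvec m i) (Uᵀ *ᵥ bvec m j)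
    = ∑ j, μ (Uᵀ *ᵥ bvec m i) (bvec m j) ⬝ᵥ ν (Uᵀ *ᵥ bvec m i) (bvec m j) :=
    fun i => key _ _ (h.2.1 _) (h'.2.1 _)
  simp only [k1]
  rw [Finset.sum_comm]
  have k2 : ∀ j, ∑ i, μ (Uᵀ *ᵥ bvec m i) (bvec m j) ⬝ᵥ ν (Uᵀ *ᵥ bvec m i) (bvec m j)
    = ∑ i, μ (bvec m i) (bvec m j) ⬝ᵥ ν (bvec m i) (bvec m j) :=
    fun i => key (fun x => μ x _) (fun x => ν x _) (h.1 _) (h'.1 _)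
  simp only [k2]
  rw [Finset.sum_comm]

theorem derAct_mact {μ : Bil m} {g gi : Matrix (Fin m) (Fin m) ℝ} (hg : gi * g = 1)
    (E : Matrix (Fin m) (Fin m) ℝ) :
    derAct (g * E * gi) (mact g μ) = mact g (derAct E μ) := by
  have hinv : g⁻¹ = gi := Matrix.inv_eq_left_inv hg
  funext X Y
  simp only [derAct, mact, hinv, Matrix.mulVec_mulVec, Matrix.mulVec_sub]
  rw [mul_assoc (g * E), hg, mul_one, ← mul_assoc gi, ← mul_assoc gi, hg, one_mul]

theorem isDerivation_iff {μ : Bil m} {E : Matrix (Fin m) (Fin m) ℝ} :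
    IsDerivation μ E ↔ derAct E μ = 0 := by
  refine ⟨derAct_of_derivation, fun h X Y => ?_⟩
  have := congrFun (congrFun h X) Y
  simp only [derAct, Pi.zero_apply] at this
  rw [sub_sub, sub_eq_zero] at this
  exact this

theorem mact_zero (g : Matrix (Fin m) (Fin m) ℝ) : mact g 0 = 0 := by
  funext X Y
  simp [mact]

theorem isDerivation_mact {μ : Bil m} {g gi : Matrix (Fin m) (Fin m) ℝ} (hg : gi * g = 1)
    {E : Matrix (Fin m) (Fin m) ℝ} (h : IsDerivation μ E) :
    IsDerivation (mact g μ) (g * E * gi) := by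
  rw [isDerivation_iff] at *
  rw [derAct_mact hg, h, mact_zero]

theorem ricM_mact {μ : Bil m} (h : IsSkewBil μ) {U : Matrix (Fin m) (Fin m) ℝ} (hU : Uᵀ * U = 1) :
    RicM (mact U μ) = U * RicM μ * Uᵀ := by
  have hU' : U * Uᵀ = 1 := mul_eq_one_comm.mp hU
  rw [Matrix.ext_iff_trace_mul_right]
  intro E
  rw [ricM_trace (mact_skew h U)]
  have : E = U * (Uᵀ * E * U) * Uᵀ := by
    rw [← mul_assoc, ← mul_assoc, hU', one_mul, mul_assoc, hU', mul_one]
  conv_lhs => rw [this]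
  rw [derAct_mact hU, ipV_mact (derAct_skew h _) h hU, ← ricM_trace h]
  rw [← mul_assoc, Matrix.trace_mul_comm]
  simp only [mul_assoc]

theorem ricc_mact {J : Matrix (Fin m) (Fin m) ℝ} {μ : Bil m} (h : IsSkewBil μ)
    {U : Matrix (Fin m) (Fin m) ℝ} (hU : Uᵀ * U = 1) :
    Ricc (U * J * Uᵀ) (mact U μ) = U * Ricc J μ * Uᵀ := by
  simp only [Ricc, ricM_mact h hU, mul_smul_comm, smul_mul_assoc, mul_sub, sub_mul]
  congr 2
  calc U * J * Uᵀ * (U * RicM μ * Uᵀ) * (U * J * Uᵀ)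
      = U * J * (Uᵀ * U) * RicM μ * (Uᵀ * U) * J * Uᵀ := by simp only [mul_assoc]
    _ = _ := by rw [hU]; simp only [mul_assoc, one_mul, mul_one]

theorem ricM_smul (t : ℝ) (μ : Bil m) : RicM (t • μ) = t ^ 2 • RicM μ := by
  ext x y
  simp only [RicM, Matrix.of_apply, Pi.smul_apply, Matrix.smul_apply, smul_eq_mul, mul_add,
    Finset.mul_sum]
  congr 1 <;>
  exact Finset.sum_congr rfl fun i _ => Finset.sum_congr rfl fun j _ => by ring

theorem ricc_smul (J : Matrix (Fin m) (Fin m) ℝ) (t : ℝ) (μ : Bil m) :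
    Ricc J (t • μ) = t ^ 2 • Ricc J μ := by
  simp only [Ricc, ricM_smul, mul_smul_comm, smul_mul_assoc, ← smul_sub, smul_comm (t ^ 2)]

theorem ricM_symm (μ : Bil m) : (RicM μ)ᵀ = RicM μ := by
  ext x y
  simp only [RicM, Matrix.transpose_apply, Matrix.of_apply]
  congr 2 <;>
  exact Finset.sum_congr rfl fun i _ => Finset.sum_congr rfl fun j _ => by ring

theorem ricc_symm {J : Matrix (Fin m) (Fin m) ℝ} (hJ : Jᵀ = -J) (μ : Bil m) :
    (Ricc J μ)ᵀ = Ricc J μ := by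
  simp only [Ricc, Matrix.transpose_smul, Matrix.transpose_sub, Matrix.transpose_mul, ricM_symm, hJ]
  simp [mul_assoc]

theorem ricc_comm {J : Matrix (Fin m) (Fin m) ℝ} (hJ : J * J = -1) (μ : Bil m) :
    Ricc J μ * J = J * Ricc J μ := by
  simp only [Ricc, mul_smul_comm, smul_mul_assoc, mul_sub, sub_mul]
  congr 1
  rw [mul_assoc _ J J, hJ, ← mul_assoc, ← mul_assoc, hJ]
  simp
  abel

theorem ipV_diag {μ : Bil m} (h : IsSkewBil μ) (a : Fin m → ℝ) :
    ipV (derAct (Matrix.diagonal a) μ) μ =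
      ∑ i, ∑ j, ∑ k, (a k - a i - a j) * (μ (bvec m i) (bvec m j) k) ^ 2 := by
  simp only [ipV, dotProduct, derAct_coord h]
  refine Finset.sum_congr rfl fun i _ => Finset.sum_congr rfl fun j _ =>
      Finset.sum_congr rfl fun k _ => ?_
  simp [Matrix.diagonal_apply]
  ring

/-- strictly raising matrices for the weights `d`. -/
def UpM (d : Fin m → ℝ) (N : Matrix (Fin m) (Fin m) ℝ) : Prop := ∀ j i, ¬ d i < d j → N j i = 0

/-- block diagonal matrices for the weights `d`. -/
def BlkM (d : Fin m → ℝ) (N : Matrix (Fin m) (Fin m) ℝ) : Prop := ∀ j i, d i ≠ d j → N j i = 0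

theorem blkM_iff {d : Fin m → ℝ} {N : Matrix (Fin m) (Fin m) ℝ} :
    BlkM d N ↔ N * Matrix.diagonal d = Matrix.diagonal d * N := by
  constructor
  · intro h
    ext i j
    rw [Matrix.mul_diagonal, Matrix.diagonal_mul]
    by_cases hd : d j = d i
    · rw [hd, mul_comm]
    · rw [h _ _ hd]; simp
  · intro h i j hd
    have := congrFun (congrFun h i) j
    rw [Matrix.mul_diagonal, Matrix.diagonal_mul] at this
    have h2 : N i j * (d j - d i) = 0 := by linarith
    rcases mul_eq_zero.mp h2 with h3 | h3
    · exact h3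
    · exact absurd (by linarith) hd

theorem UpM.blk_mul {d : Fin m → ℝ} {P N Q : Matrix (Fin m) (Fin m) ℝ} (hN : UpM d N)
    (hP : BlkM d P) (hQ : BlkM d Q) : UpM d (P * N * Q) := by
  intro j i hij
  rw [Matrix.mul_apply]
  refine Finset.sum_eq_zero fun b _ => ?_
  by_cases hb : d i = d b
  · rw [Matrix.mul_apply, Finset.sum_eq_zero, zero_mul]
    intro a _
    by_cases ha : d a = d j
    · rw [hN a b (by rw [ha, ← hb]; exact hij), mul_zero]
    · rw [hP _ _ ha, zero_mul]
  · rw [hQ _ _ hb, mul_zero]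

theorem upM_one_add {d : Fin m → ℝ} {w : Matrix (Fin m) (Fin m) ℝ} (h : UpM d (w - 1)) :
    IsUnit w ∧ UpM d (w⁻¹ - 1) := by
  have hbt : w.BlockTriangular (fun i => - d i) := by
    intro i j hij
    have hij' : d i < d j := by simpa using hij
    have := h i j (not_lt.mpr hij'.le)
    have hne : i ≠ j := by rintro rfl; exact lt_irrefl _ hij'
    simpa [Matrix.one_apply_ne hne] using this
  have hdet : w.det = 1 := by
    rw [hbt.det]
    refine Finset.prod_eq_one fun a _ => ?_
    have : w.toSquareBlock (fun i => - d i) a = 1 := by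
      ext ⟨i, hi⟩ ⟨j, hj⟩
      have hd : d i = d j := by
        have : - d i = - d j := hi.trans hj.symm
        linarith
      have := h i j (by rw [hd]; exact lt_irrefl _)
      rw [Matrix.sub_apply, sub_eq_zero] at this
      simp [Matrix.toSquareBlock_def, this, Matrix.one_apply]
    rw [this, Matrix.det_one]
  have hu : IsUnit w.det := by rw [hdet]; exact isUnit_one
  refine ⟨(Matrix.isUnit_iff_isUnit_det _).mpr hu, ?_⟩
  let _ := Matrix.invertibleOfIsUnitDet w hu
  have hi := Matrix.blockTriangular_inv_of_blockTriangular hbt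
  have e : w⁻¹ - 1 = - (w⁻¹ * (w - 1)) := by
    rw [mul_sub, Matrix.nonsing_inv_mul _ hu]; simp
  intro j i hij
  rw [e, Matrix.neg_apply, Matrix.mul_apply, Finset.sum_eq_zero, neg_zero]
  intro a _
  by_cases ha : d i < d a
  · rw [hi (i := j) (j := a), zero_mul]
    have : d j < d a := lt_of_le_of_lt (not_lt.mp hij) ha
    simpa using this
  · rw [h _ _ ha, mul_zero]

theorem exists_orth {h : Matrix (Fin m) (Fin m) ℝ} (hh : h.PosDef) (d : Fin m → ℝ) :
    ∃ w : Matrix (Fin m) (Fin m) ℝ, UpM d (w - 1) ∧ ∀ l i, d i < d l → (h * w) l i = 0 := by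
  have key : ∀ i, ∃ x : Vec m, (∀ l, ¬ d i < d l → x l = 0) ∧
      ∀ l, d i < d l → (h *ᵥ (bvec m i + x)) l = 0 := by
    intro i
    let S := {l // d i < d l}
    let hS : Matrix S S ℝ := h.submatrix Subtype.val Subtype.val
    have hpd : hS.PosDef := hh.submatrix Subtype.val_injective
    have hu : IsUnit hS.det := (Matrix.isUnit_iff_isUnit_det _).mp hpd.isUnit
    let y : S → ℝ := hS⁻¹ *ᵥ (fun l => - h l.1 i)
    have hy : hS *ᵥ y = fun l => - h l.1 i := by
      simp only [y, Matrix.mulVec_mulVec, Matrix.mul_nonsing_inv _ hu, Matrix.one_mulVec]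
    refine ⟨fun l => if hl : d i < d l then y ⟨l, hl⟩ else 0, fun l hl => by simp [hl], ?_⟩
    intro l hl
    have h1 := congrFun hy ⟨l, hl⟩
    rw [Matrix.mulVec_add, Pi.add_apply]
    have h2 : (h *ᵥ bvec m i) l = h l i := by simp [bvec]
    have h3 : (h *ᵥ fun l => if hl : d i < d l then y ⟨l, hl⟩ else 0) l
        = (hS *ᵥ y) ⟨l, hl⟩ := by
      simp only [Matrix.mulVec, dotProduct, hS, Matrix.submatrix_apply]
      rw [← Fintype.sum_subtype_add_sum_subtype (fun a => d i < d a)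
        (fun a => h l a * if hl : d i < d a then y ⟨a, hl⟩ else 0)]
      rw [Finset.sum_eq_zero (s := (Finset.univ : Finset {a // ¬ d i < d a})) (by
        rintro ⟨a, ha⟩ _; simp [ha]), add_zero]
      refine Finset.sum_congr rfl fun a _ => ?_
      simp [a.2]
    rw [h2, h3, h1]; ring
  choose x hx1 hx2 using key
  refine ⟨1 + Matrix.of fun l i => x i l, ?_, ?_⟩
  · intro j i hij
    simpa using hx1 i j hij
  · intro l i hli
    rw [← hx2 i l hli]
    simp only [Matrix.mul_apply, Matrix.mulVec, dotProduct]
    refine Finset.sum_congr rfl fun a _ => ?_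
    simp [bvec, Matrix.one_apply, Pi.single_apply]

theorem orth_unique {h : Matrix (Fin m) (Fin m) ℝ} (hh : h.PosDef) {d : Fin m → ℝ}
    {y : Matrix (Fin m) (Fin m) ℝ} (hy : UpM d y) (hy2 : ∀ l i, d i < d l → (h * y) l i = 0) :
    y = 0 := by
  have : ∀ i, (fun l => y l i) = 0 := by
    intro i
    by_contra hne
    have := hh.dotProduct_mulVec_pos hne
    refine this.ne' ?_
    simp only [dotProduct]
    refine Finset.sum_eq_zero fun l _ => ?_
    by_cases hl : d i < d l
    · have h1 := hy2 l i hl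
      rw [Matrix.mul_apply] at h1
      simp only [Matrix.mulVec, dotProduct, h1, mul_zero]
    · simp [hy l i hl]
  ext l i
  exact congrFun (this i) l

theorem exists_diag {H : Matrix (Fin m) (Fin m) ℝ} (hH : Hᵀ = H) :
    ∃ (O : Matrix (Fin m) (Fin m) ℝ) (q : Fin m → ℝ), Oᵀ * O = 1 ∧
      H = O * Matrix.diagonal q * Oᵀ := by
  have hh : H.IsHermitian := by
    rw [Matrix.IsHermitian, Matrix.conjTranspose_eq_transpose_of_trivial, hH]
  refine ⟨hh.eigenvectorUnitary, hh.eigenvalues, ?_, ?_⟩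
  · have := Unitary.coe_star_mul_self hh.eigenvectorUnitary
    rwa [Matrix.star_eq_conjTranspose, Matrix.conjTranspose_eq_transpose_of_trivial] at this
  · have := hh.spectral_theorem
    rw [Unitary.conjStarAlgAut_apply, Matrix.star_eq_conjTranspose,
      Matrix.conjTranspose_eq_transpose_of_trivial] at this
    simpa using this

theorem conj_comm {O X : Matrix (Fin m) (Fin m) ℝ} (hO : Oᵀ * O = 1) (E : Matrix (Fin m) (Fin m) ℝ) :
    X * (O * E * Oᵀ) = (O * E * Oᵀ) * X ↔ (Oᵀ * X * O) * E = E * (Oᵀ * X * O) := by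
  have hO' : O * Oᵀ = 1 := mul_eq_one_comm.mp hO
  constructor
  · intro h
    calc (Oᵀ * X * O) * E = Oᵀ * (X * (O * E * Oᵀ)) * O := by
          simp only [mul_assoc, hO, mul_one]
      _ = (Oᵀ * O) * E * (Oᵀ * X * O) := by rw [h]; simp only [mul_assoc]
      _ = _ := by rw [hO, one_mul]
  · intro h
    calc X * (O * E * Oᵀ) = (O * Oᵀ) * X * (O * E * Oᵀ) := by rw [hO', one_mul]
      _ = O * ((Oᵀ * X * O) * E) * Oᵀ := by simp only [mul_assoc]
      _ = O * E * Oᵀ * X * (O * Oᵀ) := by rw [h]; simp only [mul_assoc]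
      _ = _ := by rw [hO', mul_one]

theorem fun_comm {O X : Matrix (Fin m) (Fin m) ℝ} (hO : Oᵀ * O = 1) {q : Fin m → ℝ} (f : ℝ → ℝ)
    (h : X * (O * Matrix.diagonal q * Oᵀ) = (O * Matrix.diagonal q * Oᵀ) * X) :
    X * (O * Matrix.diagonal (fun i => f (q i)) * Oᵀ)
      = (O * Matrix.diagonal (fun i => f (q i)) * Oᵀ) * X := by
  rw [conj_comm hO, ← blkM_iff] at *
  intro j i hij
  exact h j i fun e => hij (congrArg f e)

theorem decomp {d : Fin m → ℝ} {J g : Matrix (Fin m) (Fin m) ℝ} (hJ : Jᵀ = -J) (hJ2 : J * J = -1)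
    (hJd : J * Matrix.diagonal d = Matrix.diagonal d * J) (hg : IsUnit g) (hgJ : g * J = J * g) :
    ∃ (k u O : Matrix (Fin m) (Fin m) ℝ) (r : Fin m → ℝ), 
      g = k * u * (O * Matrix.diagonal r * Oᵀ) ∧ kᵀ * k = 1 ∧ k * J = J * k ∧
      UpM d (u - 1) ∧ UpM d (u⁻¹ - 1) ∧ Oᵀ * O = 1 ∧ (∀ i, 0 < r i) ∧
      J * (O * Matrix.diagonal r * Oᵀ) = (O * Matrix.diagonal r * Oᵀ) * J ∧
      Matrix.diagonal d * (O * Matrix.diagonal r * Oᵀ)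
        = (O * Matrix.diagonal r * Oᵀ) * Matrix.diagonal d := by
  have posd : ∀ T : Matrix (Fin m) (Fin m) ℝ, IsUnit T → (Tᵀ * T).PosDef := by
    intro T hT
    rw [← Matrix.conjTranspose_eq_transpose_of_trivial]
    exact Matrix.PosDef.conjTranspose_mul_self _ (Matrix.mulVec_injective_iff_isUnit.mpr hT)
  have comJ : ∀ T : Matrix (Fin m) (Fin m) ℝ, T * J = J * T → J * (Tᵀ * T) = (Tᵀ * T) * J := by
    intro T hT
    have h1 : J * Tᵀ = Tᵀ * J := by
      have := congrArg Matrix.transpose hT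
      rw [Matrix.transpose_mul, Matrix.transpose_mul, hJ] at this
      simpa using this
    rw [← mul_assoc, h1, mul_assoc, ← hT, mul_assoc]
  have hJb : BlkM d J := blkM_iff.mpr hJd
  have hh := posd g hg
  obtain ⟨w, hw1, hw2⟩ := exists_orth hh d
  have hwJ : w * J = J * w := by
    have : w + J * w * J = 0 := by
      refine orth_unique hh (d := d) ?_ ?_
      · have h1 := hw1.blk_mul hJb hJb
        have e : w + J * w * J = (w - 1) + J * (w - 1) * J := by
          rw [mul_sub, sub_mul, mul_one, hJ2]; abel
        intro j i hij
        rw [e, Matrix.add_apply, hw1 j i hij, h1 j i hij, add_zero]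
      · intro l i hli
        have e : gᵀ * g * (w + J * w * J) = gᵀ * g * w + J * (gᵀ * g * w) * J := by
          rw [mul_add, ← mul_assoc, ← mul_assoc, ← comJ g hgJ]
          simp only [mul_assoc]
        rw [e, Matrix.add_apply, hw2 l i hli, zero_add, Matrix.mul_apply]
        refine Finset.sum_eq_zero fun b _ => ?_
        by_cases hb : d i = d b
        · rw [Matrix.mul_apply, Finset.sum_eq_zero, zero_mul]
          intro a _
          by_cases ha : d a = d l
          · rw [hw2 a b (by rw [ha, ← hb]; exact hli), mul_zero]
          · rw [hJb _ _ ha, zero_mul]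
        · rw [hJb _ _ hb, mul_zero]
    have h2 : (w + J * w * J) * J = 0 := by rw [this, zero_mul]
    rw [add_mul, mul_assoc _ J J, hJ2, mul_neg, mul_one, ← sub_eq_add_neg, sub_eq_zero] at h2
    exact h2
  obtain ⟨hwu, hwi⟩ := upM_one_add hw1
  set T := g * w with hT
  have hTu : IsUnit T := hg.mul hwu
  have hTJ : T * J = J * T := by rw [hT, mul_assoc, hwJ, ← mul_assoc, hgJ, mul_assoc]
  have hTT := posd T hTu
  have hTsym : (Tᵀ * T)ᵀ = Tᵀ * T := by simp
  have hup : ∀ l i, d i < d l → (Tᵀ * T) l i = 0 := by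
    intro l i hli
    have e : Tᵀ * T = wᵀ * (gᵀ * g * w) := by
      rw [hT, Matrix.transpose_mul]; simp only [mul_assoc]
    rw [e, Matrix.mul_apply]
    refine Finset.sum_eq_zero fun a _ => ?_
    by_cases ha : d i < d a
    · rw [hw2 a i ha, mul_zero]
    · have hal : d a < d l := lt_of_le_of_lt (not_lt.mp ha) hli
      have h1 := hw1 a l (not_lt.mpr hal.le)
      have hne : a ≠ l := by rintro rfl; exact lt_irrefl _ hal
      rw [Matrix.sub_apply, Matrix.one_apply_ne hne, sub_zero] at h1
      rw [Matrix.transpose_apply, h1, zero_mul]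
  have hTd : BlkM d (Tᵀ * T) := by
    intro j i hij
    rcases lt_or_gt_of_ne hij with h | h
    · exact hup _ _ h
    · rw [← hTsym, Matrix.transpose_apply]; exact hup _ _ h
  obtain ⟨O, q, hO, hq⟩ := exists_diag hTsym
  have hO' : O * Oᵀ = 1 := mul_eq_one_comm.mp hO
  have hqpos : ∀ i, 0 < q i := by
    intro i
    have hOu : IsUnit O := IsUnit.of_mul_eq_one _ hO'
    have h1 := hTT.conjTranspose_mul_mul_same (B := O) (Matrix.mulVec_injective_iff_isUnit.mpr hOu)
    rw [Matrix.conjTranspose_eq_transpose_of_trivial, hq] at h1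
    have e : Oᵀ * (O * Matrix.diagonal q * Oᵀ) * O = Matrix.diagonal q := by
      calc _ = (Oᵀ * O) * Matrix.diagonal q * (Oᵀ * O) := by simp only [mul_assoc]
        _ = _ := by rw [hO, one_mul, mul_one]
    rw [e] at h1
    exact Matrix.posDef_diagonal_iff.mp h1 i
  have hJp := fun_comm (X := J) hO Real.sqrt (q := q) (by rw [← hq]; exact comJ T hTJ)
  have hDp := fun_comm (X := Matrix.diagonal d) hO Real.sqrt (q := q)
    (by rw [← hq]; exact (blkM_iff.mp hTd).symm)
  set p := O * Matrix.diagonal (fun i => Real.sqrt (q i)) * Oᵀ with hp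
  have hpp : p * p = Tᵀ * T := by
    rw [hq, hp]
    calc _ = O * Matrix.diagonal (fun i => Real.sqrt (q i)) * (Oᵀ * O) *
        Matrix.diagonal (fun i => Real.sqrt (q i)) * Oᵀ := by simp only [mul_assoc]
      _ = _ := by
        rw [hO, mul_one, mul_assoc O, Matrix.diagonal_mul_diagonal]
        simp only [Real.mul_self_sqrt (hqpos _).le]
  have hpsym : pᵀ = p := by
    rw [hp]; simp [Matrix.transpose_mul, mul_assoc]
  have hpu : IsUnit p := by
    have : IsUnit (p * p) := by rw [hpp]; exact hTT.isUnit
    exact (IsUnit.of_mul_eq_one (p * (Ring.inverse (p * p)))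
      (by rw [← mul_assoc]; exact Ring.mul_inverse_cancel _ this))
  have hpd : IsUnit p.det := (Matrix.isUnit_iff_isUnit_det _).mp hpu
  have hwd : IsUnit w.det := (Matrix.isUnit_iff_isUnit_det _).mp hwu
  have hp1 : p * p⁻¹ = 1 := Matrix.mul_nonsing_inv _ hpd
  have hp2 : p⁻¹ * p = 1 := Matrix.nonsing_inv_mul _ hpd
  have invcomm : ∀ X : Matrix (Fin m) (Fin m) ℝ, X * p = p * X → X * p⁻¹ = p⁻¹ * X := by
    intro X hX
    calc X * p⁻¹ = (p⁻¹ * p) * X * p⁻¹ := by rw [hp2, one_mul]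
      _ = p⁻¹ * (X * p) * p⁻¹ := by rw [hX]; simp only [mul_assoc]
      _ = p⁻¹ * X * (p * p⁻¹) := by simp only [mul_assoc]
      _ = _ := by rw [hp1, mul_one]
  have hpb : BlkM d p := blkM_iff.mpr hDp.symm
  have hpib : BlkM d p⁻¹ := blkM_iff.mpr (invcomm _ hDp).symm
  have hui : (p * w⁻¹ * p⁻¹)⁻¹ = p * w * p⁻¹ := by
    refine Matrix.inv_eq_left_inv ?_
    calc _ = p * (w * ((p⁻¹ * p) * w⁻¹)) * p⁻¹ := by simp only [mul_assoc]
      _ = 1 := by rw [hp2, one_mul, Matrix.mul_nonsing_inv _ hwd, mul_one, hp1]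
  refine ⟨T * p⁻¹, p * w⁻¹ * p⁻¹, O, fun i => Real.sqrt (q i), ?_, ?_, ?_, ?_, ?_, hO,
    fun i => Real.sqrt_pos.mpr (hqpos i), hJp, hDp⟩
  · rw [← hp]
    calc g = g * (w * w⁻¹) := by rw [Matrix.mul_nonsing_inv _ hwd, mul_one]
      _ = T * (p⁻¹ * p) * w⁻¹ * (p⁻¹ * p) := by rw [hp2, hT]; simp only [mul_assoc, mul_one]
      _ = _ := by simp only [mul_assoc]
  · rw [Matrix.transpose_mul, Matrix.transpose_nonsing_inv, hpsym]
    calc _ = p⁻¹ * (Tᵀ * T) * p⁻¹ := by simp only [mul_assoc]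
      _ = (p⁻¹ * p) * (p * p⁻¹) := by rw [← hpp]; simp only [mul_assoc]
      _ = 1 := by rw [hp1, hp2, one_mul]
  · rw [mul_assoc, ← invcomm J hJp, ← mul_assoc, hTJ, mul_assoc]
  · have : p * w⁻¹ * p⁻¹ - 1 = p * (w⁻¹ - 1) * p⁻¹ := by
      rw [mul_sub, sub_mul, mul_one, hp1]
    rw [this]
    exact hwi.blk_mul hpb hpib
  · have : p * w * p⁻¹ - 1 = p * (w - 1) * p⁻¹ := by
      rw [mul_sub, sub_mul, mul_one, hp1]
    rw [hui, this]
    exact hw1.blk_mul hpb hpib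

theorem mact_coord {ν : Bil m} (h : IsSkewBil ν) (u : Matrix (Fin m) (Fin m) ℝ) (i j k : Fin m) :
    mact u ν (bvec m i) (bvec m j) k =
      ∑ c, ∑ a, ∑ b, u k c * (u⁻¹ a i * u⁻¹ b j * ν (bvec m a) (bvec m b) c) := by
  simp only [mact]
  rw [Matrix.mulVec, dotProduct]
  refine Finset.sum_congr rfl fun c _ => ?_
  rw [skew_expand_apply h, Finset.mul_sum]
  refine Finset.sum_congr rfl fun a _ => ?_
  rw [Finset.mul_sum]
  refine Finset.sum_congr rfl fun b _ => ?_
  simp [bvec]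

theorem weight_zero {ν : Bil m} (h : IsSkewBil ν) {d : Fin m → ℝ}
    (hd : IsDerivation ν (Matrix.diagonal d)) (i j k : Fin m) (hne : d k ≠ d i + d j) :
    ν (bvec m i) (bvec m j) k = 0 := by
  have h1 := derAct_coord h (Matrix.diagonal d) i j k
  rw [derAct_of_derivation hd] at h1
  simp [Matrix.diagonal_apply] at h1
  have h2 : (d k - (d i + d j)) * ν (bvec m i) (bvec m j) k = 0 := by linarith
  rcases mul_eq_zero.mp h2 with h3 | h3
  · exact absurd (by linarith) hne
  · exact h3

theorem weight_low {ν : Bil m} (h : IsSkewBil ν) {d : Fin m → ℝ}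
    (hd : IsDerivation ν (Matrix.diagonal d)) {u : Matrix (Fin m) (Fin m) ℝ}
    (hu : UpM d (u - 1)) (hui : UpM d (u⁻¹ - 1)) (i j k : Fin m) (hk : d k ≤ d i + d j) :
    mact u ν (bvec m i) (bvec m j) k = ν (bvec m i) (bvec m j) k := by
  have ent : ∀ w : Matrix (Fin m) (Fin m) ℝ, UpM d (w - 1) → ∀ a b, ¬ d b < d a →
      w a b = (1 : Matrix (Fin m) (Fin m) ℝ) a b := by
    intro w hw a b hab
    have := hw a b hab
    rwa [Matrix.sub_apply, sub_eq_zero] at this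
  have lo : ∀ w : Matrix (Fin m) (Fin m) ℝ, UpM d (w - 1) → ∀ a b, d a < d b → w a b = 0 := by
    intro w hw a b hab
    rw [ent w hw a b (not_lt.mpr hab.le), Matrix.one_apply_ne]
    rintro rfl; exact lt_irrefl _ hab
  rw [mact_coord h]
  conv_rhs => rw [← mact_one ν, mact_coord h, inv_one]
  refine Finset.sum_congr rfl fun c _ => Finset.sum_congr rfl fun a _ =>
      Finset.sum_congr rfl fun b _ => ?_
  by_cases hc : d c = d a + d b
  · by_cases h1 : d k < d c
    · rw [lo u hu _ _ h1, lo 1 (by intro _ _ _; simp) _ _ h1]; ring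
    by_cases h2 : d a < d i
    · rw [lo u⁻¹ hui _ _ h2, lo 1 (by intro _ _ _; simp) _ _ h2]; ring
    by_cases h3 : d b < d j
    · rw [lo u⁻¹ hui _ _ h3, lo 1 (by intro _ _ _; simp) _ _ h3]; ring
    push Not at h1 h2 h3
    rw [ent u hu k c (by linarith), ent u⁻¹ hui a i (by linarith), ent u⁻¹ hui b j (by linarith)]
  · rw [weight_zero h hd a b c hc]; ring

theorem posdef_fix {J O : Matrix (Fin m) (Fin m) ℝ} (hJ : J * J = -1) {μ : Bil m}
    (h : IsSkewBil μ) {r : Fin m → ℝ} (hO : Oᵀ * O = 1) (hr : ∀ i, 0 < r i)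
    (hJp : J * (O * Matrix.diagonal r * Oᵀ) = (O * Matrix.diagonal r * Oᵀ) * J)
    (hRic : Ricc J (mact (O * Matrix.diagonal r * Oᵀ) μ) = Ricc J μ) :
    mact (O * Matrix.diagonal r * Oᵀ) μ = μ := by
  have hO' : O * Oᵀ = 1 := mul_eq_one_comm.mp hO
  have hOt : Oᵀᵀ * Oᵀ = 1 := by rw [Matrix.transpose_transpose, hO']
  have hJA := fun_comm (X := J) hO Real.log hJp
  set p := O * Matrix.diagonal r * Oᵀ with hp
  set A := O * Matrix.diagonal (fun i => Real.log (r i)) * Oᵀ with hA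
  have hν := mact_skew h p
  have e1 := ricc_trace hJ h hJA.symm
  have e2 := ricc_trace hJ hν hJA.symm
  rw [hRic, e1] at e2
  have e3 : ipV (derAct A μ) μ = ipV (derAct A (mact p μ)) (mact p μ) := by linarith
  have conj : ∀ κ : Bil m, IsSkewBil κ → ipV (derAct A κ) κ =
      ipV (derAct (Matrix.diagonal (fun i => Real.log (r i))) (mact Oᵀ κ)) (mact Oᵀ κ) := by
    intro κ hκ
    have : Matrix.diagonal (fun i => Real.log (r i)) = Oᵀ * A * O := by
      rw [hA]
      calc _ = (Oᵀ * O) * Matrix.diagonal (fun i => Real.log (r i)) * (Oᵀ * O) := by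
            rw [hO, one_mul, mul_one]
        _ = _ := by simp only [mul_assoc]
    rw [this, derAct_mact hO', ipV_mact (derAct_skew hκ _) hκ hOt]
  set μ1 := mact Oᵀ μ with hμ1
  have hs1 : IsSkewBil μ1 := mact_skew h _
  have hν1 : mact Oᵀ (mact p μ) = mact (Matrix.diagonal r) μ1 := by
    rw [hμ1, ← mact_mul, ← mact_mul, hp, ← mul_assoc, ← mul_assoc, hO, one_mul]
  rw [conj _ h, conj _ hν, hν1, ipV_diag hs1, ipV_diag (mact_skew hs1 _)] at e3
  have hinv : (Matrix.diagonal r)⁻¹ = Matrix.diagonal (fun i => (r i)⁻¹) := by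
    refine Matrix.inv_eq_left_inv ?_
    rw [Matrix.diagonal_mul_diagonal, ← Matrix.diagonal_one]
    congr 1
    funext i
    exact inv_mul_cancel₀ (hr i).ne'
  have hco : ∀ i j k, mact (Matrix.diagonal r) μ1 (bvec m i) (bvec m j) k =
      (r k / (r i * r j)) * μ1 (bvec m i) (bvec m j) k := by
    intro i j k
    rw [mact_coord hs1, hinv]
    simp [Matrix.diagonal_apply]
    field_simp
  have hlog : ∀ i j k, Real.log (r k) - Real.log (r i) - Real.log (r j) =
      Real.log (r k / (r i * r j)) := by
    intro i j k
    rw [Real.log_div (hr k).ne' (mul_pos (hr i) (hr j)).ne',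
      Real.log_mul (hr i).ne' (hr j).ne']
    ring
  have hspos : ∀ i j k, 0 < r k / (r i * r j) :=
    fun i j k => div_pos (hr k) (mul_pos (hr i) (hr j))
  simp only [hco, hlog] at e3
  rw [eq_comm, ← sub_eq_zero] at e3
  simp only [← Finset.sum_sub_distrib] at e3
  have hls : ∀ s : ℝ, 0 < s → 0 ≤ Real.log s * (s ^ 2 - 1) := by
    intro s hs
    rcases le_total s 1 with h1 | h1
    · have := Real.log_nonpos hs.le h1
      exact mul_nonneg_of_nonpos_of_nonpos this (by nlinarith)
    · have := Real.log_nonneg h1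
      exact mul_nonneg this (by nlinarith)
  have hterm : ∀ i j k, 0 ≤ Real.log (r k / (r i * r j)) *
        (r k / (r i * r j) * μ1 (bvec m i) (bvec m j) k) ^ 2 -
        Real.log (r k / (r i * r j)) * (μ1 (bvec m i) (bvec m j) k) ^ 2 := by
    intro i j k
    have h1 := mul_nonneg (hls _ (hspos i j k)) (sq_nonneg (μ1 (bvec m i) (bvec m j) k))
    refine h1.trans (le_of_eq ?_)
    ring
  have hz : ∀ i j k, Real.log (r k / (r i * r j)) *
        (r k / (r i * r j) * μ1 (bvec m i) (bvec m j) k) ^ 2 -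
        Real.log (r k / (r i * r j)) * (μ1 (bvec m i) (bvec m j) k) ^ 2 = 0 := by
    intro i j k
    have h1 := (Finset.sum_eq_zero_iff_of_nonneg (fun i _ => Finset.sum_nonneg fun j _ =>
      Finset.sum_nonneg fun k _ => hterm i j k)).mp e3 i (Finset.mem_univ _)
    have h2 := (Finset.sum_eq_zero_iff_of_nonneg (fun j _ =>
      Finset.sum_nonneg fun k _ => hterm i j k)).mp h1 j (Finset.mem_univ _)
    exact (Finset.sum_eq_zero_iff_of_nonneg (fun k _ => hterm i j k)).mp h2 k (Finset.mem_univ _)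
  have heq : mact (Matrix.diagonal r) μ1 = μ1 := by
    refine skew_ext (mact_skew hs1 _) hs1 fun i j k => ?_
    rw [hco]
    have h1 := hz i j k
    have hs := hspos i j k
    generalize r k / (r i * r j) = s at h1 hs ⊢
    generalize μ1 (bvec m i) (bvec m j) k = x at h1 ⊢
    have h2 : Real.log s * ((s ^ 2 - 1) * x ^ 2) = 0 := by linarith
    rcases mul_eq_zero.mp h2 with h3 | h3
    · have : s = 1 := Real.eq_one_of_pos_of_log_eq_zero hs h3
      rw [this, one_mul]
    · rcases mul_eq_zero.mp h3 with h4 | h4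
      · have : s = 1 := by nlinarith
        rw [this, one_mul]
      · have : x = 0 := by simpa using h4
        rw [this, mul_zero]
  rw [heq] at hν1
  have := congrArg (mact O) hν1
  rw [hμ1, ← mact_mul, ← mact_mul, hO', one_mul, ← mact_mul, hO', mact_one] at this
  exact this

theorem core_diag {J g : Matrix (Fin m) (Fin m) ℝ} (hJ : Jᵀ = -J) (hJ2 : J * J = -1)
    {μ : Bil m} (h : IsSkewBil μ) (hg : IsUnit g) (hgJ : g * J = J * g)
    {d : Fin m → ℝ} (hD : IsDerivation μ (Matrix.diagonal d))
    (hmin : Ricc J μ = -1 + Matrix.diagonal d)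
    {D' : Matrix (Fin m) (Fin m) ℝ} (hD' : IsDerivation (mact g μ) D')
    (hmin' : Ricc J (mact g μ) = -1 + D') :
    ∃ k : Matrix (Fin m) (Fin m) ℝ, k * J = J * k ∧ kᵀ * k = 1 ∧ mact g μ = mact k μ := by
  set D := Matrix.diagonal d with hDd
  have hDJ : D * J = J * D := by
    have := ricc_comm hJ2 μ
    rw [hmin, add_mul, mul_add] at this
    simpa using this
  have hD'J : D' * J = J * D' := by
    have := ricc_comm hJ2 (mact g μ)
    rw [hmin', add_mul, mul_add] at this
    simpa using this
  have hD's : D'ᵀ = D' := by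
    have := ricc_symm hJ (mact g μ)
    rw [hmin', Matrix.transpose_add] at this
    simpa using this
  have hgd : IsUnit g.det := (Matrix.isUnit_iff_isUnit_det _).mp hg
  have hg1 : g * g⁻¹ = 1 := Matrix.mul_nonsing_inv _ hgd
  have hg2 : g⁻¹ * g = 1 := Matrix.nonsing_inv_mul _ hgd
  have hgiJ : g⁻¹ * J = J * g⁻¹ := by
    calc g⁻¹ * J = g⁻¹ * (J * g) * g⁻¹ := by simp only [mul_assoc, hg1, mul_one]
      _ = (g⁻¹ * g) * J * g⁻¹ := by rw [← hgJ]; simp only [mul_assoc]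
      _ = _ := by rw [hg2, one_mul]
  -- trace relations
  have trD : ∀ (κ : Bil m) (F E : Matrix (Fin m) (Fin m) ℝ), IsSkewBil κ → Ricc J κ = -1 + F →
      IsDerivation κ E → E * J = J * E → (F * E).trace = E.trace := by
    intro κ F E hκ hF hE hEJ
    have h1 := ricc_trace hJ2 hκ hEJ
    rw [derAct_of_derivation hE, hF, add_mul, Matrix.trace_add] at h1
    simp [ipV] at h1
    linarith
  have t1 := trD μ D D h hmin hD hDJ
  have t2 := trD _ D' D' (mact_skew h g) hmin' hD' hD'J
  have t3 := trD _ D' (g * D * g⁻¹) (mact_skew h g) hmin' (isDerivation_mact hg2 hD)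
    (by rw [mul_assoc, hgiJ, ← mul_assoc, mul_assoc g, hDJ, ← mul_assoc, hgJ]
        simp only [mul_assoc])
  have hD2 : IsDerivation μ (g⁻¹ * D' * g) := by
    have := isDerivation_mact hg1 hD'
    rwa [← mact_mul, hg2, mact_one] at this
  have t4 := trD μ D (g⁻¹ * D' * g) h hmin hD2
    (by rw [mul_assoc, hgJ, ← mul_assoc, mul_assoc g⁻¹, hD'J, ← mul_assoc, hgiJ]
        simp only [mul_assoc])
  have c1 : (g * D * g⁻¹).trace = D.trace := by
    rw [Matrix.trace_mul_comm, ← mul_assoc, hg2, one_mul]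
  have c2 : (g⁻¹ * D' * g).trace = D'.trace := by
    rw [Matrix.trace_mul_comm, ← mul_assoc, hg1, one_mul]
  have c3 : (D * (g⁻¹ * D' * g)).trace = (D' * (g * D * g⁻¹)).trace := by
    rw [← mul_assoc, Matrix.trace_mul_comm, ← mul_assoc, ← mul_assoc, Matrix.trace_mul_comm]
  have trEq : D'.trace = D.trace := by rw [← c2, ← t4, c3, t3, c1]
  obtain ⟨k, u, O, r, hgk, hk, hkJ, hu, hui, hO, hr, hJp, hDp⟩ := decomp hJ hJ2 hDJ.symm hg hgJ
  set p := O * Matrix.diagonal r * Oᵀ with hp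
  have hk' : k * kᵀ = 1 := mul_eq_one_comm.mp hk
  have hktk : kᵀᵀ * kᵀ = 1 := by rw [Matrix.transpose_transpose, hk']
  have hO' : O * Oᵀ = 1 := mul_eq_one_comm.mp hO
  -- p is invertible
  have hpi : ∃ pi : Matrix (Fin m) (Fin m) ℝ, pi * p = 1 := by
    refine ⟨O * Matrix.diagonal (fun i => (r i)⁻¹) * Oᵀ, ?_⟩
    calc _ = O * (Matrix.diagonal (fun i => (r i)⁻¹) * (Oᵀ * O) * Matrix.diagonal r) * Oᵀ := by
          rw [hp]; simp only [mul_assoc]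
      _ = 1 := by
        rw [hO, mul_one, Matrix.diagonal_mul_diagonal]
        have : (fun i => (r i)⁻¹ * r i) = fun _ => (1:ℝ) := by
          funext i; exact inv_mul_cancel₀ (hr i).ne'
        rw [this, Matrix.diagonal_one, mul_one, hO']
  obtain ⟨pi, hpi⟩ := hpi
  have hpi' : p * pi = 1 := mul_eq_one_comm.mp hpi
  set ν := mact p μ with hν
  have hνs : IsSkewBil ν := mact_skew h p
  have hνD : IsDerivation ν D := by
    have := isDerivation_mact hpi hD
    rwa [← hDp, mul_assoc, hpi', mul_one] at this
  set ν' := mact u ν with hν'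
  have hν's : IsSkewBil ν' := mact_skew hνs u
  have hgν : mact g μ = mact k ν' := by
    rw [hgk, mact_mul, mact_mul]
  have hν'g : ν' = mact kᵀ (mact g μ) := by
    rw [hgν, ← mact_mul, hk, mact_one]
  have hktJ : kᵀ * J * k = J := by rw [mul_assoc, ← hkJ, ← mul_assoc, hk, one_mul]
  set D1 := kᵀ * D' * k with hD1
  have hRν' : Ricc J ν' = -1 + D1 := by
    have := ricc_mact (J := J) (mact_skew h g) hktk
    rw [Matrix.transpose_transpose, hktJ, ← hν'g, hmin', mul_add, add_mul] at this
    rw [this]; simp [hk, hD1]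
  have hD1s : D1ᵀ = D1 := by
    rw [hD1]; simp [Matrix.transpose_mul, hD's, mul_assoc]
  have s1 : D1.trace = D.trace := by
    rw [hD1, Matrix.trace_mul_comm, ← mul_assoc, hk', one_mul, trEq]
  have s2 : (D1 * D1).trace = D.trace := by
    have : D1 * D1 = kᵀ * (D' * D') * k := by
      calc _ = kᵀ * D' * (k * kᵀ) * D' * k := by rw [hD1]; simp only [mul_assoc]
        _ = _ := by rw [hk', mul_one]; simp only [mul_assoc]
    rw [this, Matrix.trace_mul_comm, ← mul_assoc, hk', one_mul, t2, trEq]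
  have s3 := ricc_trace hJ2 hν's hDJ
  rw [hRν', add_mul, Matrix.trace_add, hDd, ipV_diag hν's, ← hDd] at s3
  have hterm : ∀ i j k, 0 ≤ (d k - d i - d j) * (ν' (bvec m i) (bvec m j) k) ^ 2 := by
    intro i j k
    rcases lt_or_ge (d k) (d i + d j) with hlt | hge
    · rw [hν', weight_low hνs hνD hu hui i j k hlt.le, weight_zero hνs hνD i j k hlt.ne]
      simp
    · exact mul_nonneg (by linarith) (sq_nonneg _)
  have hsum : 0 ≤ ∑ i, ∑ j, ∑ k, (d k - d i - d j) * (ν' (bvec m i) (bvec m j) k) ^ 2 :=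
    Finset.sum_nonneg fun i _ => Finset.sum_nonneg fun j _ => Finset.sum_nonneg fun k _ =>
      hterm i j k
  have s4 : D.trace ≤ (D1 * D).trace := by
    rw [neg_one_mul, Matrix.trace_neg] at s3
    linarith
  have hDs : Dᵀ = D := by rw [hDd]; simp
  have s5 : ((D1 - D)ᵀ * (D1 - D)).trace ≤ 0 := by
    rw [Matrix.transpose_sub, hD1s, hDs, sub_mul, mul_sub, mul_sub, Matrix.trace_sub,
      Matrix.trace_sub, Matrix.trace_sub, s2, t1, Matrix.trace_mul_comm D D1]
    linarith
  have hDD : D1 = D := by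
    have h1 : ((D1 - D)ᵀ * (D1 - D)).trace = ∑ i, ∑ j, ((D1 - D) j i) ^ 2 := by
      simp only [Matrix.trace, Matrix.diag_apply, Matrix.mul_apply, Matrix.transpose_apply, sq]
    rw [h1] at s5
    have h2 := le_antisymm s5
      (Finset.sum_nonneg fun i _ => Finset.sum_nonneg fun j _ => sq_nonneg _)
    ext j i
    have h3 := (Finset.sum_eq_zero_iff_of_nonneg (fun i _ => Finset.sum_nonneg fun j _ =>
      sq_nonneg _)).mp h2 i (Finset.mem_univ _)
    have h4 := (Finset.sum_eq_zero_iff_of_nonneg (fun j _ =>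
      sq_nonneg _)).mp h3 j (Finset.mem_univ _)
    have h5 : (D1 - D) j i = 0 := by simpa using h4
    rwa [Matrix.sub_apply, sub_eq_zero] at h5
  have hsum0 : ∑ i, ∑ j, ∑ k, (d k - d i - d j) * (ν' (bvec m i) (bvec m j) k) ^ 2 = 0 := by
    rw [hDD, neg_one_mul, Matrix.trace_neg, t1] at s3
    linarith
  have hνν : ν' = ν := by
    refine skew_ext hν's hνs fun i j k => ?_
    rcases le_or_gt (d k) (d i + d j) with hle | hgt
    · exact weight_low hνs hνD hu hui i j k hle
    · rw [weight_zero hνs hνD i j k hgt.ne']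
      have h1 := (Finset.sum_eq_zero_iff_of_nonneg (fun i _ => Finset.sum_nonneg fun j _ =>
        Finset.sum_nonneg fun k _ => hterm i j k)).mp hsum0 i (Finset.mem_univ _)
      have h2 := (Finset.sum_eq_zero_iff_of_nonneg (fun j _ =>
        Finset.sum_nonneg fun k _ => hterm i j k)).mp h1 j (Finset.mem_univ _)
      have h3 := (Finset.sum_eq_zero_iff_of_nonneg (fun k _ => hterm i j k)).mp h2 k
        (Finset.mem_univ _)
      rcases mul_eq_zero.mp h3 with h4 | h4
      · linarith
      · simpa using h4
  have hfix : ν = μ := by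
    refine posdef_fix hJ2 h hO hr hJp ?_
    rw [← hp, ← hν, ← hνν, hRν', hDD, hmin]
  exact ⟨k, hkJ, hk, by rw [hgν, hνν, hfix]⟩

theorem core {J g : Matrix (Fin m) (Fin m) ℝ} (hJ : Jᵀ = -J) (hJ2 : J * J = -1)
    {μ : Bil m} (h : IsSkewBil μ) (hg : IsUnit g) (hgJ : g * J = J * g)
    {D : Matrix (Fin m) (Fin m) ℝ} (hD : IsDerivation μ D)
    (hmin : Ricc J μ = -1 + D)
    {D' : Matrix (Fin m) (Fin m) ℝ} (hD' : IsDerivation (mact g μ) D')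
    (hmin' : Ricc J (mact g μ) = -1 + D') :
    ∃ k : Matrix (Fin m) (Fin m) ℝ, k * J = J * k ∧ kᵀ * k = 1 ∧ mact g μ = mact k μ := by
  have hDs : Dᵀ = D := by
    have := ricc_symm hJ μ
    rw [hmin, Matrix.transpose_add] at this
    simpa using this
  obtain ⟨O, d, hO, hDO⟩ := exists_diag hDs
  have hO' : O * Oᵀ = 1 := mul_eq_one_comm.mp hO
  have hOt : Oᵀᵀ * Oᵀ = 1 := by rw [Matrix.transpose_transpose, hO']
  have cj : ∀ X Y : Matrix (Fin m) (Fin m) ℝ, (Oᵀ * X * O) * (Oᵀ * Y * O) = Oᵀ * (X * Y) * O := by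
    intro X Y
    calc _ = Oᵀ * X * (O * Oᵀ) * Y * O := by simp only [mul_assoc]
      _ = _ := by rw [hO', mul_one]; simp only [mul_assoc]
  have cj' : ∀ X Y : Matrix (Fin m) (Fin m) ℝ, (O * X * Oᵀ) * (O * Y * Oᵀ) = O * (X * Y) * Oᵀ := by
    intro X Y
    calc _ = O * X * (Oᵀ * O) * Y * Oᵀ := by simp only [mul_assoc]
      _ = _ := by rw [hO, mul_one]; simp only [mul_assoc]
  have back : ∀ X : Matrix (Fin m) (Fin m) ℝ, O * (Oᵀ * X * O) * Oᵀ = X := by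
    intro X
    calc _ = (O * Oᵀ) * X * (O * Oᵀ) := by simp only [mul_assoc]
      _ = _ := by rw [hO', one_mul, mul_one]
  have hDd : Oᵀ * D * O = Matrix.diagonal d := by
    rw [hDO]
    calc _ = (Oᵀ * O) * Matrix.diagonal d * (Oᵀ * O) := by simp only [mul_assoc]
      _ = _ := by rw [hO, one_mul, mul_one]
  have hOu : IsUnit O := IsUnit.of_mul_eq_one _ hO'
  have hOtu : IsUnit Oᵀ := IsUnit.of_mul_eq_one _ hO
  have hgact : mact (Oᵀ * g * O) (mact Oᵀ μ) = mact Oᵀ (mact g μ) := by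
    rw [← mact_mul, ← mact_mul, mul_assoc, hO', mul_one]
  obtain ⟨k, hkJ, hk, hgk⟩ := core_diag (J := Oᵀ * J * O) (g := Oᵀ * g * O) (μ := mact Oᵀ μ)
    (d := d) (D' := Oᵀ * D' * O)
    (by simp [Matrix.transpose_mul, hJ, mul_assoc])
    (by rw [cj, hJ2]; simp [hO]) (mact_skew h _) ((hOtu.mul hg).mul hOu)
    (by rw [cj, cj, hgJ])
    (by rw [← hDd]; exact isDerivation_mact hO' hD)
    (by
      have := ricc_mact (J := J) h hOt
      rw [Matrix.transpose_transpose] at this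
      rw [this, hmin, mul_add, add_mul, hDd]; simp [hO])
    (by rw [hgact]; exact isDerivation_mact hO' hD')
    (by
      have := ricc_mact (J := J) (mact_skew h g) hOt
      rw [Matrix.transpose_transpose] at this
      rw [hgact, this, hmin', mul_add, add_mul]; simp [hO])
  refine ⟨O * k * Oᵀ, ?_, ?_, ?_⟩
  · have h1 : O * (k * (Oᵀ * J * O)) * Oᵀ = O * (Oᵀ * J * O * k) * Oᵀ := by rw [hkJ]
    rw [← cj' k (Oᵀ * J * O), ← cj' (Oᵀ * J * O) k, back] at h1
    exact h1
  · have : (O * k * Oᵀ)ᵀ = O * kᵀ * Oᵀ := by simp [Matrix.transpose_mul, mul_assoc]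
    rw [this, cj', hk, mul_one, hO']
  · have h1 := congrArg (mact O) hgk
    rw [hgact, ← mact_mul, hO', mact_one, ← mact_mul, ← mact_mul] at h1
    exact h1

theorem const_neg {J : Matrix (Fin m) (Fin m) ℝ} (hJ : Jᵀ = -J) (hJ2 : J * J = -1)
    {μ : Bil m} (h : IsSkewBil μ) (h0 : μ ≠ 0) {c : ℝ} {D : Matrix (Fin m) (Fin m) ℝ}
    (hD : IsDerivation μ D) (hmin : Ricc J μ = c • (1 : Matrix (Fin m) (Fin m) ℝ) + D) : c < 0 := by
  have hone : derAct 1 μ = - μ := by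
    funext X Y
    simp [derAct]
  have hN : 0 < ipV μ μ := by
    have hnn : ∀ i j, 0 ≤ μ (bvec m i) (bvec m j) ⬝ᵥ μ (bvec m i) (bvec m j) := fun i j =>
      Finset.sum_nonneg fun k _ => mul_self_nonneg _
    refine lt_of_le_of_ne (Finset.sum_nonneg fun i _ => Finset.sum_nonneg fun j _ => hnn i j) ?_
    intro he
    apply h0
    have hz : ∀ i j, μ (bvec m i) (bvec m j) = 0 := by
      intro i j
      have h1 := (Finset.sum_eq_zero_iff_of_nonneg (fun i _ => Finset.sum_nonneg fun j _ =>
        hnn i j)).mp he.symm i (Finset.mem_univ _)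
      have h2 := (Finset.sum_eq_zero_iff_of_nonneg (fun j _ => hnn i j)).mp h1 j (Finset.mem_univ _)
      exact dotProduct_self_eq_zero.mp h2
    funext X Y
    rw [skew_expand h]
    simp [hz]
  have ipneg : ipV (-μ) μ = - ipV μ μ := by
    simp [ipV]
  have e1 := ricc_trace hJ2 h (E := 1) (by simp)
  rw [hone, ipneg, mul_one] at e1
  have hDJ : D * J = J * D := by
    have := ricc_comm hJ2 μ
    rw [hmin, add_mul, mul_add] at this
    simpa using this
  have e2 := ricc_trace hJ2 h hDJ
  rw [derAct_of_derivation hD] at e2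
  have e2' : (Ricc J μ * D).trace = 0 := by rw [e2]; simp [ipV]
  have e3 : (Ricc J μ * Ricc J μ).trace = c * (Ricc J μ).trace := by
    conv_lhs => rw [hmin, mul_add, ← hmin, Matrix.trace_add, e2']
    simp
  have e4 : 0 ≤ (Ricc J μ * Ricc J μ).trace := by
    conv_rhs => rw [← ricc_symm hJ μ]
    rw [ricc_symm hJ μ]
    have : (Ricc J μ * Ricc J μ).trace = ((Ricc J μ)ᵀ * Ricc J μ).trace := by rw [ricc_symm hJ μ]
    rw [this]
    simp only [Matrix.trace, Matrix.diag_apply, Matrix.mul_apply, Matrix.transpose_apply]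
    exact Finset.sum_nonneg fun i _ => Finset.sum_nonneg fun j _ => mul_self_nonneg _
  have e5 : (Ricc J μ * Ricc J μ).trace ≠ 0 := by
    intro he
    have : Ricc J μ = 0 := by
      have h1 : ((Ricc J μ)ᴴ * Ricc J μ).trace = 0 := by
        rw [Matrix.conjTranspose_eq_transpose_of_trivial, ricc_symm hJ μ, he]
      exact Matrix.trace_conjTranspose_mul_self_eq_zero_iff.mp h1
    rw [this] at e1
    simp at e1
    linarith
  have e6 : 0 < c * (Ricc J μ).trace := by rw [← e3]; exact lt_of_le_of_ne e4 e5.symm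
  rw [e1] at e6
  nlinarith

theorem isDerivation_smul {μ : Bil m} (hs : IsSkewBil μ) {D : Matrix (Fin m) (Fin m) ℝ}
    (h : IsDerivation μ D) (s t : ℝ) : IsDerivation (s • μ) (t • D) := by
  intro X Y
  have h1 := (hs.1 Y).map_smul t (D *ᵥ X)
  have h2 := (hs.2.1 X).map_smul t (D *ᵥ Y)
  simp only [Pi.smul_apply, Matrix.smul_mulVec, Matrix.mulVec_smul, h X Y]
  rw [h1, h2, smul_add, smul_add]

theorem mact_smul_left {μ : Bil m} (hs : IsSkewBil μ) {g : Matrix (Fin m) (Fin m) ℝ}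
    (hg : IsUnit g) {t : ℝ} (ht : t ≠ 0) : mact (t • g) μ = t⁻¹ • mact g μ := by
  have hgd : IsUnit g.det := (Matrix.isUnit_iff_isUnit_det _).mp hg
  have hinv : (t • g)⁻¹ = t⁻¹ • g⁻¹ := by
    refine Matrix.inv_eq_left_inv ?_
    rw [smul_mul_smul_comm, Matrix.nonsing_inv_mul _ hgd, inv_mul_cancel₀ ht, one_smul]
  funext X Y
  have h1 := (hs.1 (t⁻¹ • g⁻¹ *ᵥ Y)).map_smul t⁻¹ (g⁻¹ *ᵥ X)
  have h2 := (hs.2.1 (g⁻¹ *ᵥ X)).map_smul t⁻¹ (g⁻¹ *ᵥ Y)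
  simp only [mact, hinv, Matrix.smul_mulVec, Pi.smul_apply]
  rw [h1, h2, Matrix.mulVec_smul, Matrix.mulVec_smul, smul_smul, smul_smul]
  congr 1
  field_simp

theorem final {J g : Matrix (Fin m) (Fin m) ℝ} (hJ : Jᵀ = -J) (hJ2 : J * J = -1)
    {μ : Bil m} (h : IsSkewBil μ) (h0 : μ ≠ 0) (hg : IsUnit g) (hgJ : g * J = J * g)
    {c : ℝ} {D : Matrix (Fin m) (Fin m) ℝ} (hD : IsDerivation μ D)
    (hmin : Ricc J μ = c • (1 : Matrix (Fin m) (Fin m) ℝ) + D)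
    {c' : ℝ} {D' : Matrix (Fin m) (Fin m) ℝ} (hD' : IsDerivation (mact g μ) D')
    (hmin' : Ricc J (mact g μ) = c' • (1 : Matrix (Fin m) (Fin m) ℝ) + D') :
    ∃ (k : Matrix (Fin m) (Fin m) ℝ) (t : ℝ), t ≠ 0 ∧
      IsCxMat J k ∧ kᵀ * k = 1 ∧ mact g μ = t • mact k μ := by
  have hgd : IsUnit g.det := (Matrix.isUnit_iff_isUnit_det _).mp hg
  have h0' : mact g μ ≠ 0 := by
    intro he
    apply h0
    have := congrArg (mact g⁻¹) he
    rwa [← mact_mul, Matrix.nonsing_inv_mul _ hgd, mact_one, mact_zero] at this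
  have hc := const_neg hJ hJ2 h h0 hD hmin
  have hc' := const_neg hJ hJ2 (mact_skew h g) h0' hD' hmin'
  have sc : ∀ c : ℝ, c < 0 → ∃ s : ℝ, s ≠ 0 ∧ s ^ 2 * c = -1 := by
    intro c hc
    have hpos : 0 < -c := by linarith
    refine ⟨(Real.sqrt (-c))⁻¹, inv_ne_zero (Real.sqrt_pos.mpr hpos).ne', ?_⟩
    rw [inv_pow, Real.sq_sqrt hpos.le]
    have hcn : c ≠ 0 := hc.ne
    field_simp
  obtain ⟨s, hs, hsc⟩ := sc c hc
  obtain ⟨s', hs', hsc'⟩ := sc c' hc'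
  have hact : mact ((s / s') • g) (s • μ) = s' • mact g μ := by
    rw [mact_smul_left (smul_skew h s) hg (div_ne_zero hs hs'), mact_smul, smul_smul]
    congr 1
    field_simp
  have hsu : IsUnit ((s / s') • g) := by
    rw [Matrix.isUnit_iff_isUnit_det, Matrix.det_smul]
    exact (IsUnit.pow _ (div_ne_zero hs hs').isUnit).mul hgd
  obtain ⟨k, hkJ, hk, hgk⟩ := core hJ hJ2 (smul_skew h s) (g := (s / s') • g) hsu
    (by rw [smul_mul_assoc, mul_smul_comm, hgJ])
    (D := s ^ 2 • D) (isDerivation_smul h hD _ _)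
    (by rw [ricc_smul, hmin, smul_add, smul_smul, hsc, neg_one_smul])
    (D' := s' ^ 2 • D') (by rw [hact]; exact isDerivation_smul (mact_skew h g) hD' _ _)
    (by rw [hact, ricc_smul, hmin', smul_add, smul_smul, hsc', neg_one_smul])
  refine ⟨k, s / s', div_ne_zero hs hs', ⟨?_, hkJ⟩, hk, ?_⟩
  · exact IsUnit.of_mul_eq_one _ (mul_eq_one_comm.mp hk)
  · rw [hact, mact_smul] at hgk
    rw [div_eq_inv_mul, mul_smul, ← hgk, smul_smul, inv_mul_cancel₀ hs', one_smul]

end helpers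

/-- a minimal compatible metric on an (almost-)complex nilpotent Lie group is
unique up to isometry and scaling. -/
theorem minimal_unique_complex (n : ℕ) (hn : 1 ≤ n)
    (J : Matrix (Fin (2 * n)) (Fin (2 * n)) ℝ) (hJskew : Jᵀ = -J) (hJsq : J * J = -1)
    (μ : Bil (2 * n)) (hμ : NilBracket μ) (hμ0 : μ ≠ 0)
    (g : Matrix (Fin (2 * n)) (Fin (2 * n)) ℝ) (hg : IsCxMat J g)
    (c : ℝ) (D : Matrix (Fin (2 * n)) (Fin (2 * n)) ℝ) (hD : IsDerivation μ D)
    (hmin : Ricc J μ = c • (1 : Matrix (Fin (2 * n)) (Fin (2 * n)) ℝ) + D)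
    (c' : ℝ) (D' : Matrix (Fin (2 * n)) (Fin (2 * n)) ℝ) (hD' : IsDerivation (mact g μ) D')
    (hmin' : Ricc J (mact g μ) = c' • (1 : Matrix (Fin (2 * n)) (Fin (2 * n)) ℝ) + D') :
    ∃ (k : Matrix (Fin (2 * n)) (Fin (2 * n)) ℝ) (t : ℝ), t ≠ 0 ∧
      IsCxMat J k ∧ kᵀ * k = 1 ∧ mact g μ = t • mact k μ := by
  exact final hJskew hJsq hμ.1 hμ0 hg.1 hg.2 hD hmin hD' hmin'
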